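/- arXiv:1407.0169 — 2 statements merged into one kernel-verified Lean document; each statement's English description precedes it below -/
import Mathlib

section
/- Let q be a prime power and ℓ, m, n positive integers. For every linear finite transducer M over F_q with structural parameters ℓ, m, n and r = rank(Δ_M), the number of LFTs in L_{ℓ,m,n} equivalent to M is |[M]_{∼_n}| = ∏_{i=0}^{r−1}(q^n − q^i) · q^{(n+ℓ)(n−r)}. -/
/-- Extension of the state transition function of a finite transducer to finite words. -/
def deltaStar {X S : Type*} (δ : S → X → S) : S → List X → S
  | s, [] => s
  | s, a :: w => deltaStar δ (δ s a) w

/-- Extension of the output function of a finite transducer to finite words. -/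
def lambdaStar {X Y S : Type*} (δ : S → X → S) (lam : S → X → Y) : S → List X → List Y
  | _, [] => []
  | s, a :: w => lam s a :: lambdaStar δ lam (δ s a) w

/-- A linear finite transducer over `F` with structural parameters `ℓ, m, n`, identified
with its quadruple of structural matrices `(A, B, C, D)`; its input alphabet is `F^ℓ`,
its output alphabet is `F^m` and its state space is `F^n`. -/
structure LFT (F : Type) [Field F] (ℓ m n : ℕ) where
  A : Matrix (Fin n) (Fin n) F
  B : Matrix (Fin n) (Fin ℓ) F
  C : Matrix (Fin m) (Fin n) F
  D : Matrix (Fin m) (Fin ℓ) F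

namespace LFT

variable {F : Type} [Field F] {ℓ m n n₁ n₂ : ℕ}

/-- The state transition function `δ(s, x) = As + Bx` of a linear finite transducer. -/
def del (M : LFT F ℓ m n) (s : Fin n → F) (x : Fin ℓ → F) : Fin n → F :=
  M.A.mulVec s + M.B.mulVec x

/-- The output function `λ(s, x) = Cs + Dx` of a linear finite transducer. -/
def out (M : LFT F ℓ m n) (s : Fin n → F) (x : Fin ℓ → F) : Fin m → F :=
  M.C.mulVec s + M.D.mulVec x

/-- Two states are equivalent when the transducers produce the same output word from them
on every finite input word. -/
def StateEquiv (M₁ : LFT F ℓ m n₁) (M₂ : LFT F ℓ m n₂)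
    (s₁ : Fin n₁ → F) (s₂ : Fin n₂ → F) : Prop :=
  ∀ α : List (Fin ℓ → F), lambdaStar M₁.del M₁.out s₁ α = lambdaStar M₂.del M₂.out s₂ α

/-- Two linear finite transducers are equivalent if every state of each one is equivalent
to some state of the other. -/
def Equiv (M₁ : LFT F ℓ m n₁) (M₂ : LFT F ℓ m n₂) : Prop :=
  (∀ s₁, ∃ s₂, StateEquiv M₁ M₂ s₁ s₂) ∧ (∀ s₂, ∃ s₁, StateEquiv M₁ M₂ s₁ s₂)

/-- A linear finite transducer is minimal if it has no pair of distinct equivalent states. -/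
def Minimal (M : LFT F ℓ m n) : Prop :=
  ∀ s s' : Fin n → F, StateEquiv M M s s' → s = s'

/-- The diagnostic matrix `Δ_M = [C; CA; …; CA^{n−1}]` of a linear finite transducer,
with the `mn` rows indexed by `Fin (n * m)` (row `i` is row `i % m` of `C * A ^ (i / m)`). -/
def diagMat (M : LFT F ℓ m n) : Matrix (Fin (n * m)) (Fin n) F :=
  Matrix.of fun i j =>
    (M.C * M.A ^ ((i : ℕ) / m))
      ⟨(i : ℕ) % m, Nat.mod_lt _ (Nat.pos_of_ne_zero fun h => by
        have hpos : 0 < n * m := Nat.lt_of_le_of_lt (Nat.zero_le _) i.isLt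
        rw [h, Nat.mul_zero] at hpos
        exact absurd hpos (lt_irrefl 0))⟩ j

end LFT

/-- A family of `k` vectors in `F^N` is in reduced row echelon form if there are strictly
increasing pivot positions where each vector has a leading `1` (with zeros in that
coordinate for the other vectors) and zeros before its pivot. -/
def IsRREF {F : Type} [Field F] {k N : ℕ} (b : Fin k → Fin N → F) : Prop :=
  ∃ p : Fin k → Fin N, StrictMono p ∧
    (∀ i i' : Fin k, b i' (p i) = if i' = i then 1 else 0) ∧
    ∀ (i : Fin k) (c : Fin N), (c : ℕ) < (p i : ℕ) → b i c = 0

/-- A linear finite transducer of size `n` is canonical if the columns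
`Δ_M e₁, …, Δ_M eₙ` of its diagnostic matrix form the standard basis (the reduced row
echelon form basis) of the column space `{Δ_M s ∣ s}` of `Δ_M`: they are linearly
independent (hence a basis of the column space, which they always span) and in RREF. -/
def LFT.IsCanonical {F : Type} [Field F] {ℓ m n : ℕ} (M : LFT F ℓ m n) : Prop :=
  LinearIndependent F (fun j : Fin n => fun r : Fin (n * m) => M.diagMat r j) ∧
    IsRREF (fun j : Fin n => fun r : Fin (n * m) => M.diagMat r j)

namespace LFT

variable {F : Type} [Field F] {ℓ m n n₁ n₂ : ℕ}

/-- free response -/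
def Phi (M : LFT F ℓ m n) : (Fin n → F) →ₗ[F] (ℕ → Fin m → F) :=
  LinearMap.pi fun k => (M.C * M.A ^ k).mulVecLin

lemma Phi_apply (M : LFT F ℓ m n) (s : Fin n → F) (k : ℕ) :
    M.Phi s k = (M.C * M.A ^ k).mulVec s := rfl

lemma Phi_zero (M : LFT F ℓ m n) (s : Fin n → F) : M.Phi s 0 = M.C.mulVec s := by
  simp [Phi_apply]

lemma Phi_A (M : LFT F ℓ m n) (s : Fin n → F) (k : ℕ) :
    M.Phi (M.A.mulVec s) k = M.Phi s (k + 1) := by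
  simp [Phi_apply, pow_succ, Matrix.mul_assoc]

lemma StateEquiv.head {M₁ : LFT F ℓ m n₁} {M₂ : LFT F ℓ m n₂} {s₁ s₂}
    (h : StateEquiv M₁ M₂ s₁ s₂) (x : Fin ℓ → F) : M₁.out s₁ x = M₂.out s₂ x := by
  have := h [x]
  simpa [lambdaStar] using this

lemma StateEquiv.next {M₁ : LFT F ℓ m n₁} {M₂ : LFT F ℓ m n₂} {s₁ s₂}
    (h : StateEquiv M₁ M₂ s₁ s₂) (x : Fin ℓ → F) :
    StateEquiv M₁ M₂ (M₁.del s₁ x) (M₂.del s₂ x) := by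
  intro α
  have := h (x :: α)
  simp only [lambdaStar, List.cons.injEq] at this
  exact this.2

lemma StateEquiv.phi {M₁ : LFT F ℓ m n₁} {M₂ : LFT F ℓ m n₂} {s₁ s₂}
    (h : StateEquiv M₁ M₂ s₁ s₂) : M₁.Phi s₁ = M₂.Phi s₂ := by
  funext k
  induction k generalizing s₁ s₂ with
  | zero =>
    have := h.head 0
    simpa [Phi_zero, out] using this
  | succ k ih =>
    have := ih (h.next 0)
    simpa [del, Phi_A] using this

lemma stateEquiv_iff (M₁ : LFT F ℓ m n₁) (M₂ : LFT F ℓ m n₂) (s₁ s₂) :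
    StateEquiv M₁ M₂ s₁ s₂ ↔ M₁.Phi s₁ = M₂.Phi s₂ ∧ M₁.D = M₂.D ∧
      ∀ x, M₁.Phi (M₁.B.mulVec x) = M₂.Phi (M₂.B.mulVec x) := by
  constructor
  · intro h
    refine ⟨h.phi, ?_, ?_⟩
    · have h0 := congrFun h.phi 0
      rw [Phi_zero, Phi_zero] at h0
      apply Matrix.ext_of_mulVec_single
      intro i
      have := h.head (Pi.single i 1)
      simp only [out, h0] at this
      exact add_left_cancel this
    · intro x
      have h1 := (h.next x).phi
      have h2 : M₁.Phi (M₁.A.mulVec s₁) = M₂.Phi (M₂.A.mulVec s₂) := by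
        funext k; rw [Phi_A, Phi_A, h.phi]
      simp only [del, map_add, h2] at h1
      exact add_left_cancel h1
  · rintro ⟨h, hD, hB⟩ α
    induction α generalizing s₁ s₂ with
    | nil => rfl
    | cons x α ih =>
      simp only [lambdaStar, List.cons.injEq]
      constructor
      · have h0 := congrFun h 0
        rw [Phi_zero, Phi_zero] at h0
        simp [out, h0, hD]
      · apply ih
        have h2 : M₁.Phi (M₁.A.mulVec s₁) = M₂.Phi (M₂.A.mulVec s₂) := by
          funext k; rw [Phi_A, Phi_A, h]
        simp only [del, map_add, h2, hB]

lemma equiv_iff (M₁ : LFT F ℓ m n₁) (M₂ : LFT F ℓ m n₂) :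
    Equiv M₁ M₂ ↔ LinearMap.range M₁.Phi = LinearMap.range M₂.Phi ∧ M₁.D = M₂.D ∧
      ∀ x, M₁.Phi (M₁.B.mulVec x) = M₂.Phi (M₂.B.mulVec x) := by
  simp only [Equiv, stateEquiv_iff]
  constructor
  · rintro ⟨h1, h2⟩
    obtain ⟨_, -, hD, hB⟩ := h1 0
    refine ⟨le_antisymm ?_ ?_, hD, hB⟩
    · rintro _ ⟨s, rfl⟩
      obtain ⟨t, ht, -⟩ := h1 s
      exact ⟨t, ht.symm⟩
    · rintro _ ⟨s, rfl⟩
      obtain ⟨t, ht, -⟩ := h2 s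
      exact ⟨t, ht⟩
  · rintro ⟨h, hD, hB⟩
    refine ⟨fun s => ?_, fun s => ?_⟩
    · obtain ⟨t, ht⟩ := h.le ⟨s, rfl⟩
      exact ⟨t, ht.symm, hD, hB⟩
    · obtain ⟨t, ht⟩ := h.ge ⟨s, rfl⟩
      exact ⟨t, ht, hD, hB⟩

lemma ker_diag (M : LFT F ℓ m n) :
    LinearMap.ker M.diagMat.mulVecLin = LinearMap.ker M.Phi := by
  ext s
  simp only [LinearMap.mem_ker, Matrix.mulVecLin_apply]
  constructor
  · intro h
    have key : ∀ k < n, M.Phi s k = 0 := by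
      intro k hk
      funext j
      have hlt : k * m + j < n * m := by
        have : (k + 1) * m ≤ n * m := Nat.mul_le_mul_right _ hk
        have := j.2
        nlinarith
      have := congrFun h ⟨k * m + j, hlt⟩
      have hm : 0 < m := j.pos
      have e1 : (k * m + j) / m = k := by
        rw [mul_comm, Nat.mul_add_div hm, Nat.div_eq_of_lt j.2, add_zero]
      have e2 : (k * m + j) % m = j := by
        rw [mul_comm, Nat.mul_add_mod, Nat.mod_eq_of_lt j.2]
      simpa [diagMat, Matrix.mulVec, dotProduct, e1, e2, Phi_apply] using this
    funext k
    rcases Nat.eq_zero_or_pos n with rfl | hn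
    · rw [Subsingleton.elim s 0, map_zero]
    rw [Phi_apply, Matrix.pow_eq_aeval_mod_charpoly, Polynomial.aeval_eq_sum_range' (n := n),
      Matrix.mul_sum, Matrix.sum_mulVec]
    · apply Finset.sum_eq_zero
      intro i hi
      have := key i (Finset.mem_range.1 hi)
      rw [Phi_apply] at this
      rw [Matrix.mul_smul, Matrix.smul_mulVec, this, smul_zero]
    · have hd := Polynomial.degree_modByMonic_lt ((Polynomial.X : Polynomial F) ^ k)
        (Matrix.charpoly_monic M.A)
      rw [Matrix.charpoly_degree_eq_dim, Fintype.card_fin] at hd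
      by_cases h0 : (Polynomial.X : Polynomial F) ^ k %ₘ M.A.charpoly = 0
      · rw [h0]; simpa using hn
      · exact (Polynomial.natDegree_lt_iff_degree_lt h0).2 hd
  · intro h
    funext i
    have hm : 0 < m := by
      rcases Nat.eq_zero_or_pos m with rfl | h
      · exact absurd i.2 (by simp)
      · exact h
    have := congrFun (congrFun h (i / m)) ⟨i % m, Nat.mod_lt _ hm⟩
    simpa [diagMat, Matrix.mulVec, dotProduct, Phi_apply] using this

lemma finrank_range (M : LFT F ℓ m n) :
    Module.finrank F (LinearMap.range M.Phi) = M.diagMat.rank := by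
  have h1 := LinearMap.finrank_range_add_finrank_ker M.Phi
  have h2 := LinearMap.finrank_range_add_finrank_ker M.diagMat.mulVecLin
  rw [ker_diag] at h2
  unfold Matrix.rank
  omega

end LFT

lemma card_fiber_aux {F : Type} [Field F] [Fintype F] {n k : ℕ} {W : Type} [AddCommGroup W]
    [Module F W] (φ : (Fin n → F) →ₗ[F] W) (hφ : Function.Surjective φ)
    (g : (Fin k → F) →ₗ[F] W) :
    Nat.card {A : Matrix (Fin n) (Fin k) F // ∀ s, φ (A.mulVec s) = g s} =
      Fintype.card F ^ (k * (n - Module.finrank F W)) := by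
  classical
  have hker : Nat.card (LinearMap.ker φ) = Fintype.card F ^ (n - Module.finrank F W) := by
    have h1 := LinearMap.finrank_range_add_finrank_ker φ
    rw [LinearMap.range_eq_top.2 hφ, finrank_top, Module.finrank_fin_fun] at h1
    rw [Module.natCard_eq_pow_finrank (K := F), Nat.card_eq_fintype_card]
    congr 1
    omega
  have hfib : ∀ w : W, Nat.card {v // φ v = w} = Nat.card (LinearMap.ker φ) := by
    intro w
    obtain ⟨v0, rfl⟩ := hφ w
    refine Nat.card_congr ⟨fun v => ⟨v.1 - v0, by simp [v.2]⟩,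
      fun v => ⟨v.1 + v0, by simp [LinearMap.mem_ker.1 v.2]⟩, fun v => by simp, fun v => by simp⟩
  have e : {A : Matrix (Fin n) (Fin k) F // ∀ s, φ (A.mulVec s) = g s} ≃
      ∀ j : Fin k, {v : Fin n → F // φ v = g (Pi.single j 1)} :=
    { toFun := fun A j => ⟨fun i => A.1 i j, by
        rw [← A.2, Matrix.mulVec_single_one]; rfl⟩
      invFun := fun f => ⟨Matrix.of fun i j => (f j).1 i, by
        intro s
        have : φ ∘ₗ (Matrix.of fun i j => (f j).1 i).mulVecLin = g := by
          apply LinearMap.pi_ext'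
          intro j
          ext
          simp only [LinearMap.comp_apply, LinearMap.single_apply, Matrix.mulVecLin_apply,
            Matrix.mulVec_single_one]
          exact (f j).2
        exact LinearMap.congr_fun this s⟩
      left_inv := fun A => rfl
      right_inv := fun f => rfl }
  rw [Nat.card_congr e, Nat.card_pi]
  rw [Finset.prod_congr rfl fun j _ => (hfib _).trans hker, Finset.prod_const,
    Finset.card_univ, Fintype.card_fin, ← pow_mul, mul_comm]

lemma card_surj_aux {F : Type} [Field F] [Fintype F] {n : ℕ} {W : Type} [AddCommGroup W]
    [Module F W] [Module.Finite F W] (hr : Module.finrank F W ≤ n) :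
    Nat.card {φ : (Fin n → F) →ₗ[F] W // Function.Surjective φ} =
      ∏ i ∈ Finset.range (Module.finrank F W), (Fintype.card F ^ n - Fintype.card F ^ i) := by
  classical
  set r := Module.finrank F W with hrdef
  let e : W ≃ₗ[F] (Fin r → F) := LinearEquiv.ofFinrankEq _ _ (by simp [hrdef])
  have hc := card_linearIndependent (K := F) (V := Fin n → F) (k := r) (by simpa using hr)
  rw [Module.finrank_fin_fun] at hc
  rw [Finset.prod_range, ← hc]
  let E : ((Fin n → F) →ₗ[F] W) ≃ (Fin r → Fin n → F) :=
    ((LinearEquiv.congrRight e).trans LinearMap.toMatrix').toEquiv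
  refine Nat.card_congr (E.subtypeEquiv ?_)
  intro φ
  have hE : (Matrix.of (E φ)).mulVecLin = e.toLinearMap ∘ₗ φ := by
    change Matrix.mulVecLin (LinearMap.toMatrix' (e.toLinearMap ∘ₗ φ)) = _
    rw [← Matrix.toLin'_apply', Matrix.toLin'_toMatrix']
  have hs : Function.Surjective φ ↔ (Matrix.of (E φ)).rank = r := by
    rw [Matrix.rank, hE]
    have : Function.Surjective φ ↔ Function.Surjective (e.toLinearMap ∘ₗ φ) := by
      rw [LinearMap.coe_comp]
      exact (Function.Surjective.of_comp_iff' e.bijective φ).symm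
    rw [this, ← LinearMap.range_eq_top]
    constructor
    · intro h; rw [h]; simp
    · intro h; apply Submodule.eq_top_of_finrank_eq; simpa using h
  rw [hs, Matrix.rank_eq_finrank_span_row, linearIndependent_iff_card_eq_finrank_span,
    Fintype.card_fin, eq_comm]
  rfl

/-- for every LFT `M` over `F_q` (`q = |F|` a prime power) with structural
parameters `ℓ, m, n`, the number of LFTs with the same parameters equivalent to `M` is
`|[M]_{∼ₙ}| = ∏_{i=0}^{r−1}(qⁿ − q^i) · q^{(n+ℓ)(n−r)}`, where `r = rank Δ_M`. -/
theorem card_equiv_class {F : Type} [Field F] [Fintype F] {ℓ m n : ℕ}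
    (hℓ : 0 < ℓ) (hm : 0 < m) (hn : 0 < n) (M : LFT F ℓ m n) :
    Nat.card {M' : LFT F ℓ m n // LFT.Equiv M' M} =
      (∏ i ∈ Finset.range M.diagMat.rank,
          (Fintype.card F ^ n - Fintype.card F ^ i)) *
        Fintype.card F ^ ((n + ℓ) * (n - M.diagMat.rank)) := by
  classical
  set W := LinearMap.range M.Phi with hW
  have hrank : Module.finrank F W = M.diagMat.rank := M.finrank_range
  have hle : Module.finrank F W ≤ n := by
    rw [hrank]; simpa using Matrix.rank_le_width M.diagMat
  let shift : (ℕ → Fin m → F) →ₗ[F] (ℕ → Fin m → F) :=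
    LinearMap.pi fun k => LinearMap.proj (k + 1)
  have hshift : ∀ w ∈ W, shift w ∈ W := by
    rintro _ ⟨s, rfl⟩
    exact ⟨M.A.mulVec s, funext fun k => M.Phi_A s k⟩
  let σ : W →ₗ[F] W := shift.restrict hshift
  have hσ : ∀ (w : W) k, (σ w).1 k = w.1 (k + 1) := fun w k => rfl
  let b : (Fin ℓ → F) →ₗ[F] W := M.Phi.rangeRestrict ∘ₗ M.B.mulVecLin
  have hb : ∀ x, (b x).1 = M.Phi (M.B.mulVec x) := fun x => rfl
  let c : W →ₗ[F] (Fin m → F) := LinearMap.proj 0 ∘ₗ W.subtype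
  let T := Σ φ : {φ : (Fin n → F) →ₗ[F] W // Function.Surjective φ},
    {A : Matrix (Fin n) (Fin n) F // ∀ s, φ.1 (A.mulVec s) = (σ ∘ₗ φ.1) s} ×
    {B : Matrix (Fin n) (Fin ℓ) F // ∀ s, φ.1 (B.mulVec s) = b s}
  let mk : T → LFT F ℓ m n := fun t =>
    ⟨t.2.1.1, t.2.2.1, LinearMap.toMatrix' (c ∘ₗ t.1.1), M.D⟩
  have hPhi : ∀ (t : T) s, (mk t).Phi s = (t.1.1 s).1 := by
    intro t s
    funext k
    induction k generalizing s with
    | zero =>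
      rw [LFT.Phi_zero]
      change (LinearMap.toMatrix' (c ∘ₗ t.1.1)).mulVec s = _
      rw [LinearMap.toMatrix'_mulVec]
      rfl
    | succ k ih =>
      rw [← LFT.Phi_A, ih]
      change (t.1.1 (t.2.1.1.mulVec s)).1 k = _
      rw [t.2.1.2]
      rfl
  have hmk : ∀ t, LFT.Equiv (mk t) M := by
    intro t
    rw [LFT.equiv_iff]
    refine ⟨?_, rfl, ?_⟩
    · ext w
      constructor
      · rintro ⟨s, rfl⟩
        rw [hPhi]
        exact (t.1.1 s).2
      · intro hw
        obtain ⟨s, hs⟩ := t.1.2 ⟨w, hw⟩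
        exact ⟨s, by rw [hPhi, hs]⟩
    · intro x
      rw [hPhi]
      change (t.1.1 (t.2.2.1.mulVec x)).1 = _
      rw [t.2.2.2, hb]
  have hbij : Function.Bijective (fun t : T => (⟨mk t, hmk t⟩ : {M' // LFT.Equiv M' M})) := by
    constructor
    · intro t t' h
      have h : mk t = mk t' := congrArg Subtype.val h
      have hφ : t.1.1 = t'.1.1 := by
        refine LinearMap.ext fun s => Subtype.ext ?_
        rw [← hPhi, ← hPhi, h]
      obtain ⟨⟨φ, hs⟩, ⟨A, hA⟩, ⟨B, hB⟩⟩ := t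
      obtain ⟨⟨φ', hs'⟩, ⟨A', hA'⟩, ⟨B', hB'⟩⟩ := t'
      have hφ : φ = φ' := hφ
      subst hφ
      have h1 : A = A' := congrArg LFT.A h
      have h2 : B = B' := congrArg LFT.B h
      subst h1 h2
      rfl
    · rintro ⟨M', hM'⟩
      obtain ⟨h1, h2, h3⟩ := (LFT.equiv_iff _ _).1 hM'
      have hmem : ∀ s, M'.Phi s ∈ W := fun s => h1.le ⟨s, rfl⟩
      refine ⟨⟨⟨M'.Phi.codRestrict W hmem, ?_⟩, ⟨M'.A, ?_⟩, ⟨M'.B, ?_⟩⟩, ?_⟩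
      · rintro ⟨w, hw⟩
        obtain ⟨s, hs⟩ := h1.ge hw
        exact ⟨s, Subtype.ext hs⟩
      · intro s
        apply Subtype.ext
        funext k
        exact M'.Phi_A s k
      · intro s
        apply Subtype.ext
        exact h3 s
      · apply Subtype.ext
        obtain ⟨A', B', C', D'⟩ := M'
        have h2 : D' = M.D := h2
        subst h2
        change LFT.mk _ _ _ _ = _
        congr 1
        apply Matrix.ext_of_mulVec_single
        intro i
        rw [LinearMap.toMatrix'_mulVec]
        exact LFT.Phi_zero _ _
  rw [← Nat.card_eq_of_bijective _ hbij]
  have : Finite W := Module.finite_of_finite F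
  have : Finite {φ : (Fin n → F) →ₗ[F] W // Function.Surjective φ} := by
    have : Finite ((Fin n → F) →ₗ[F] W) := Module.finite_of_finite F
    infer_instance
  have := Fintype.ofFinite {φ : (Fin n → F) →ₗ[F] W // Function.Surjective φ}
  rw [Nat.card_sigma]
  have hf : ∀ φ : {φ : (Fin n → F) →ₗ[F] W // Function.Surjective φ},
      Nat.card ({A : Matrix (Fin n) (Fin n) F // ∀ s, φ.1 (A.mulVec s) = (σ ∘ₗ φ.1) s} ×
      {B : Matrix (Fin n) (Fin ℓ) F // ∀ s, φ.1 (B.mulVec s) = b s}) =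
      Fintype.card F ^ ((n + ℓ) * (n - M.diagMat.rank)) := by
    intro φ
    rw [Nat.card_prod, card_fiber_aux _ φ.2, card_fiber_aux _ φ.2, hrank, ← pow_add, ← add_mul]
  rw [Finset.sum_congr rfl fun φ _ => hf φ, Finset.sum_const, Finset.card_univ, smul_eq_mul,
    ← Nat.card_eq_fintype_card, card_surj_aux hle, hrank]
end

section
/- Let ℓ, m, n be positive integers with n ≥ 2. The number of non-trivial, non-minimal linear finite transducers over F_2 with structural parameters ℓ, m, n equals Σ_{i=1}^{n−1} CT(ℓ,m,i) · ∏_{j=0}^{i−1}(2^n − 2^j) · 2^{(n+ℓ)(n−i)}, where CT(ℓ,m,i) denotes the number of canonical linear finite transducers over F_2 with structural parameters ℓ, m, i. -/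
/-- The number of canonical linear finite transducers over `F₂` with structural
parameters `ℓ, m, i`. -/
noncomputable def CT (ℓ m i : ℕ) : ℕ :=
  Nat.card {M : LFT (ZMod 2) ℓ m i // M.IsCanonical}

namespace LFT

theorem finite_LFT (ℓ m n : ℕ) : Finite (LFT (ZMod 2) ℓ m n) := by
  have : Function.Injective (fun M : LFT (ZMod 2) ℓ m n => (M.A, M.B, M.C, M.D)) := by
    rintro ⟨A, B, C, D⟩ ⟨A', B', C', D'⟩ h
    simp only [Prod.mk.injEq] at h
    obtain ⟨rfl, rfl, rfl, rfl⟩ := h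
    rfl
  exact Finite.of_injective _ this

/-- Unobservable states. -/
def Ker {F : Type} [Field F] {ℓ m n : ℕ} (M : LFT F ℓ m n) (s : Fin n → F) : Prop :=
  ∀ k : ℕ, (M.C * M.A ^ k).mulVec s = 0

theorem stateEquiv_iff_s18 {F : Type} [Field F] {ℓ m n : ℕ} (M : LFT F ℓ m n) (s s' : Fin n → F) :
    StateEquiv M M s s' ↔ M.Ker (s - s') := by
  constructor
  · intro h k
    induction k generalizing s s' with
    | zero =>
      have := h [0]
      simp [lambdaStar, out] at this
      simp [Matrix.mulVec_sub, this]
    | succ k ih =>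
      have h2 : StateEquiv M M (M.A.mulVec s) (M.A.mulVec s') := by
        intro α
        have := h (0 :: α)
        simp [lambdaStar, del] at this
        exact this.2
      have := ih _ _ h2
      rw [← Matrix.mulVec_sub, Matrix.mulVec_mulVec, Matrix.mul_assoc, ← pow_succ] at this
      exact this
  · intro h α
    induction α generalizing s s' with
    | nil => rfl
    | cons a w ih =>
      simp only [lambdaStar]
      congr 1
      · have := h 0
        simp [Matrix.mulVec_sub] at this
        simp [out, sub_eq_zero.1 this]
      · apply ih
        intro k
        have := h (k + 1)
        rw [pow_succ, ← Matrix.mul_assoc, ← Matrix.mulVec_mulVec] at this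
        simpa [del, Matrix.mulVec_sub] using this

theorem minimal_iff {F : Type} [Field F] {ℓ m n : ℕ} (M : LFT F ℓ m n) :
    M.Minimal ↔ ∀ s, M.Ker s → s = 0 := by
  constructor
  · intro h s hs
    exact h s 0 ((stateEquiv_iff_s18 M s 0).2 (by simpa using hs))
  · intro h s s' hs
    exact sub_eq_zero.1 (h _ ((stateEquiv_iff_s18 M s s').1 hs))

theorem ker_iff_diag {F : Type} [Field F] {ℓ m n : ℕ} (M : LFT F ℓ m n) (s : Fin n → F) :
    M.Ker s ↔ M.diagMat.mulVec s = 0 := by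
  constructor
  · intro h
    ext r
    exact congrFun (h ((r : ℕ) / m)) _
  · intro h
    have h1 : ∀ k < n, (M.C * M.A ^ k).mulVec s = 0 := by
      intro k hk
      ext t
      have hlt : m * k + t < n * m := by
        have := t.2
        nlinarith
      have h2 := congrFun h ⟨m * k + t, hlt⟩
      have hm : 0 < m := Nat.lt_of_le_of_lt (Nat.zero_le _) t.2
      have e1 : (m * k + t) / m = k := by
        rw [Nat.mul_add_div hm, Nat.div_eq_of_lt t.2, add_zero]
      have e2 : (m * k + t) % m = t := by
        rw [Nat.mul_add_mod, Nat.mod_eq_of_lt t.2]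
      simp only [Matrix.mulVec, dotProduct, diagMat, Matrix.of_apply, e1, e2] at h2
      exact h2
    intro k
    by_cases hn : n = 0
    · subst hn
      have : s = 0 := Subsingleton.elim _ _
      simp [this]
    rw [Matrix.pow_eq_aeval_mod_charpoly]
    rw [Polynomial.aeval_eq_sum_range' (n := n)]
    · rw [Matrix.mul_sum, Matrix.sum_mulVec]
      apply Finset.sum_eq_zero
      intro j hj
      rw [Matrix.mul_smul, Matrix.smul_mulVec, h1 j (Finset.mem_range.1 hj), smul_zero]
    · have hd : M.A.charpoly.natDegree = n := by simp
      conv_rhs => rw [← hd]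
      apply Polynomial.natDegree_modByMonic_lt _ (Matrix.charpoly_monic _)
      intro h0
      rw [h0] at hd
      simp at hd
      exact hn hd.symm

theorem li_iff_ker {F : Type} [Field F] {ℓ m n : ℕ} (M : LFT F ℓ m n) :
    LinearIndependent F (fun j : Fin n => fun r : Fin (n * m) => M.diagMat r j) ↔
      ∀ s, M.Ker s → s = 0 := by
  have : (fun j : Fin n => fun r : Fin (n * m) => M.diagMat r j) = M.diagMat.col := rfl
  rw [this, ← Matrix.mulVec_injective_iff]
  constructor
  · intro h s hs
    apply h
    rw [(ker_iff_diag M s).1 hs, Matrix.mulVec_zero]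
  · intro h x y hxy
    apply sub_eq_zero.1
    apply h
    rw [ker_iff_diag, Matrix.mulVec_sub]
    exact sub_eq_zero.2 hxy

theorem diag_mul {F : Type} [Field F] {ℓ m n : ℕ} (M₁ M₂ : LFT F ℓ m n)
    (Q : Matrix (Fin n) (Fin n) F) (h : ∀ k, M₁.C * M₁.A ^ k = M₂.C * M₂.A ^ k * Q) :
    M₁.diagMat = M₂.diagMat * Q := by
  ext r j
  have := congrFun (congrFun (h ((r : ℕ) / m))
    ⟨(r : ℕ) % m, Nat.mod_lt _ (Nat.pos_of_ne_zero (by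
      rintro rfl
      exact absurd r.2 (by simp)))⟩) j
  exact this

theorem rref_unique {F : Type} [Field F] {k N : ℕ} (X Y : Matrix (Fin N) (Fin k) F)
    (Q : Matrix (Fin k) (Fin k) F) (hXY : X = Y * Q)
    (hX : IsRREF (fun j r => X r j)) (hY : IsRREF (fun j r => Y r j)) : Q = 1 := by
  classical
  obtain ⟨p, hp, hp1, hp2⟩ := hX
  obtain ⟨q, hq, hq1, hq2⟩ := hY
  simp only at hp1 hp2 hq1 hq2
  have hval : ∀ i j, X (q i) j = Q i j := by
    intro i j
    rw [hXY, Matrix.mul_apply]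
    simp [hq1]
  have hsub : ∀ j, ∃ i, p j = q i := by
    intro j
    have hne : ∃ i, Q i j ≠ 0 := by
      by_contra hc
      push Not at hc
      have h1 : X (p j) j = 0 := by
        rw [hXY, Matrix.mul_apply]
        simp [hc]
      rw [hp1] at h1
      simp at h1
    obtain ⟨i, hi, hmin⟩ : ∃ i, Q i j ≠ 0 ∧ ∀ i' < i, Q i' j = 0 := by
      have hs : (Finset.univ.filter (fun i => Q i j ≠ 0)).Nonempty := by
        obtain ⟨i, hi⟩ := hne
        exact ⟨i, by simp [hi]⟩
      refine ⟨_, (Finset.mem_filter.1 (Finset.min'_mem _ hs)).2, ?_⟩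
      intro i' hi'
      by_contra hc
      exact absurd (Finset.min'_le _ i' (by simp [hc])) (not_le.2 hi')
    refine ⟨i, ?_⟩
    have hle : p j ≤ q i := by
      by_contra hc
      have := hp2 j (q i) (not_le.1 hc)
      rw [hval] at this
      exact hi this
    refine le_antisymm hle ?_
    by_contra hc
    have hlt : p j < q i := not_le.1 hc
    have h1 : X (p j) j = 0 := by
      rw [hXY, Matrix.mul_apply]
      apply Finset.sum_eq_zero
      intro i' _
      by_cases h : i' < i
      · rw [hmin i' h, mul_zero]
      · rw [hq2 i' (p j) (lt_of_lt_of_le hlt (hq.monotone (not_lt.1 h))), zero_mul]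
    rw [hp1] at h1
    simp at h1
  have hpq : p = q := by
    apply (StrictMono.range_inj hp hq).1
    have hss : Set.range p ⊆ Set.range q := by
      rintro _ ⟨j, rfl⟩
      obtain ⟨i, hi⟩ := hsub j
      exact ⟨i, hi.symm⟩
    apply Set.eq_of_subset_of_ncard_le hss _ (Set.toFinite _)
    rw [← Set.image_univ, ← Set.image_univ, Set.ncard_image_of_injective _ hp.injective,
      Set.ncard_image_of_injective _ hq.injective]
  ext i j
  rw [← hval, ← hpq, hp1, Matrix.one_apply]
  simp [eq_comm]

theorem exists_rref {F : Type} [Field F] {k N : ℕ} (X : Matrix (Fin N) (Fin k) F)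
    (hX : ∀ s, X.mulVec s = 0 → s = 0) :
    ∃ G H : Matrix (Fin k) (Fin k) F, G * H = 1 ∧ H * G = 1 ∧
      IsRREF (fun j r => (X * G) r j) := by
  classical
  let P : Finset (Fin N) := Finset.univ.filter
    (fun c => ∃ s, X.mulVec s c ≠ 0 ∧ ∀ c' < c, X.mulVec s c' = 0)
  have hlead : ∀ s, s ≠ 0 → ∃ c ∈ P, X.mulVec s c ≠ 0 ∧ ∀ c' < c, X.mulVec s c' = 0 := by
    intro s hs
    have hne : (Finset.univ.filter (fun c => X.mulVec s c ≠ 0)).Nonempty := by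
      by_contra hc
      apply hs
      apply hX
      ext c
      by_contra h
      exact hc ⟨c, by simpa using h⟩
    have key : X.mulVec s (Finset.min' _ hne) ≠ 0 ∧
        ∀ c' < (Finset.min' _ hne), X.mulVec s c' = 0 := by
      refine ⟨(Finset.mem_filter.1 (Finset.min'_mem _ hne)).2, ?_⟩
      intro i' hi'
      by_contra hc
      exact absurd (Finset.min'_le _ i' (by simpa using hc)) (not_le.2 hi')
    exact ⟨_, Finset.mem_filter.2 ⟨Finset.mem_univ _, s, key⟩, key⟩
  have hP : ∀ c : P, ∃ s, X.mulVec s c ≠ 0 ∧ ∀ c' < (c : Fin N), X.mulVec s c' = 0 :=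
    fun c => (Finset.mem_filter.1 c.2).2
  choose v hv1 hv2 using hP
  have hli : LinearIndependent F v := by
    rw [Fintype.linearIndependent_iff]
    intro g hg
    by_contra hc
    push Not at hc
    have hs : (Finset.univ.filter (fun i => g i ≠ 0)).Nonempty := by
      obtain ⟨i, hi⟩ := hc
      exact ⟨i, by simp [hi]⟩
    set i := Finset.min' _ hs with hi
    have hi1 : g i ≠ 0 := (Finset.mem_filter.1 (Finset.min'_mem _ hs)).2
    have hi2 : ∀ i' < i, g i' = 0 := by
      intro i' hi'
      by_contra hc
      exact absurd (Finset.min'_le _ i' (by simp [hc])) (not_le.2 hi')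
    have h1 : X.mulVec (∑ j, g j • v j) i = 0 := by
      rw [hg]; simp
    rw [Matrix.mulVec_sum, Finset.sum_apply, Finset.sum_eq_single i] at h1
    · rw [Matrix.mulVec_smul, Pi.smul_apply, smul_eq_mul] at h1
      exact (mul_ne_zero hi1 (hv1 i)) h1
    · intro b _ hb
      rw [Matrix.mulVec_smul, Pi.smul_apply, smul_eq_mul]
      rcases lt_or_gt_of_ne hb with h | h
      · rw [hi2 b h, zero_mul]
      · rw [hv2 b i h, mul_zero]
    · simp
  have hle : P.card ≤ k := by
    have := hli.fintype_card_le_finrank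
    simpa using this
  have hge : k ≤ P.card := by
    let f : (Fin k → F) →ₗ[F] (P → F) := (X.submatrix (fun c : P => (c : Fin N)) id).mulVecLin
    have hf : Function.Injective f := by
      rw [← LinearMap.ker_eq_bot, LinearMap.ker_eq_bot']
      intro s hs
      by_contra hne
      obtain ⟨c, hc, h1, _⟩ := hlead s hne
      exact h1 (congrFun hs ⟨c, hc⟩)
    have := LinearMap.finrank_le_finrank_of_injective hf
    simpa using this
  have hcard : P.card = k := le_antisymm hle hge
  let p := P.orderEmbOfFin hcard
  let T : Matrix (Fin k) (Fin k) F := X.submatrix p id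
  have hT : IsUnit T := by
    rw [← Matrix.mulVec_injective_iff_isUnit]
    intro x y hxy
    have hxy : T.mulVec x = T.mulVec y := hxy
    apply sub_eq_zero.1
    by_contra hne
    obtain ⟨c, hc, h1, _⟩ := hlead _ hne
    have : c ∈ Set.range p := by
      rw [Finset.range_orderEmbOfFin]; exact hc
    obtain ⟨i, rfl⟩ := this
    apply h1
    have h2 : T.mulVec (x - y) = 0 := by
      rw [Matrix.mulVec_sub, hxy, sub_self]
    exact congrFun h2 i
  have hdet : IsUnit T.det := (Matrix.isUnit_iff_isUnit_det T).1 hT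
  refine ⟨T⁻¹, T, Matrix.nonsing_inv_mul _ hdet, Matrix.mul_nonsing_inv _ hdet, p,
    p.strictMono, ?_, ?_⟩
  · intro i i'
    have h1 : (T * T⁻¹) i i' = (1 : Matrix _ _ F) i i' := by
      rw [Matrix.mul_nonsing_inv _ hdet]
    have h2 : (T * T⁻¹) i i' = (X * T⁻¹) (p i) i' := rfl
    show (X * T⁻¹) (p i) i' = _
    rw [← h2, h1, Matrix.one_apply]
    simp [eq_comm]
  · intro i c hc
    have hval : ∀ i' : Fin k, (X * T⁻¹) (p i') i = if i = i' then 1 else 0 := by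
      intro i'
      have h1 : (T * T⁻¹) i' i = (1 : Matrix _ _ F) i' i := by
        rw [Matrix.mul_nonsing_inv _ hdet]
      have h2 : (T * T⁻¹) i' i = (X * T⁻¹) (p i') i := rfl
      rw [← h2, h1, Matrix.one_apply]
      simp [eq_comm]
    have hcol : ∀ r, (X * T⁻¹) r i = X.mulVec (T⁻¹.col i) r := fun r => rfl
    have hne : T⁻¹.col i ≠ 0 := by
      intro h0
      have h1 := hval i
      rw [hcol, h0] at h1
      simp at h1
    obtain ⟨c0, hc0, h1, h2⟩ := hlead _ hne
    have : c0 ∈ Set.range p := by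
      rw [Finset.range_orderEmbOfFin]; exact hc0
    obtain ⟨i', rfl⟩ := this
    rw [← hcol, hval] at h1
    have hii : i = i' := by
      by_contra hc
      simp [hc] at h1
    subst hii
    show (X * T⁻¹) c i = 0
    rw [hcol]
    exact h2 c hc

/-- `P` is a surjective morphism from `M` to `M'`. -/
structure Rel {F : Type} [Field F] {ℓ m n i : ℕ} (M : LFT F ℓ m n) (M' : LFT F ℓ m i)
    (P : Matrix (Fin i) (Fin n) F) : Prop where
  hA : P * M.A = M'.A * P
  hB : P * M.B = M'.B
  hC : M.C = M'.C * P
  hD : M.D = M'.D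

theorem Rel.pow {F : Type} [Field F] {ℓ m n i : ℕ} {M : LFT F ℓ m n} {M' : LFT F ℓ m i}
    {P : Matrix (Fin i) (Fin n) F} (h : Rel M M' P) (k : ℕ) : P * M.A ^ k = M'.A ^ k * P := by
  induction k with
  | zero => simp
  | succ k ih =>
    rw [pow_succ, ← Matrix.mul_assoc, ih, Matrix.mul_assoc, h.hA, ← Matrix.mul_assoc, pow_succ]

theorem Rel.obs {F : Type} [Field F] {ℓ m n i : ℕ} {M : LFT F ℓ m n} {M' : LFT F ℓ m i}
    {P : Matrix (Fin i) (Fin n) F} (h : Rel M M' P) (k : ℕ) :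
    M.C * M.A ^ k = M'.C * M'.A ^ k * P := by
  rw [h.hC, Matrix.mul_assoc, h.pow, Matrix.mul_assoc]

theorem Rel.ker {F : Type} [Field F] {ℓ m n i : ℕ} {M : LFT F ℓ m n} {M' : LFT F ℓ m i}
    {P : Matrix (Fin i) (Fin n) F} (h : Rel M M' P) (hM' : ∀ s, M'.Ker s → s = 0)
    (s : Fin n → F) : M.Ker s ↔ P.mulVec s = 0 := by
  have h1 : M.Ker s ↔ M'.Ker (P.mulVec s) := by
    simp only [Ker, Matrix.mulVec_mulVec, h.obs]
  rw [h1]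
  constructor
  · exact hM' _
  · intro h k
    rw [h, Matrix.mulVec_zero]

theorem rinv_of_li {F : Type} [Field F] {n i : ℕ} (P : Matrix (Fin i) (Fin n) F)
    (h : LinearIndependent F P.row) : ∃ R : Matrix (Fin n) (Fin i) F, P * R = 1 := by
  rw [← Matrix.mulVec_surjective_iff_exists_right_inverse]
  have h1 := h.rank_matrix
  have h2 : LinearMap.range P.mulVecLin = ⊤ := by
    apply Submodule.eq_top_of_finrank_eq
    rw [← Matrix.rank, h1]
    simp
  exact LinearMap.range_eq_top.1 h2

theorem li_of_rinv {F : Type} [Field F] {n i : ℕ} (P : Matrix (Fin i) (Fin n) F)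
    (R : Matrix (Fin n) (Fin i) F) (h : P * R = 1) : LinearIndependent F P.row := by
  rw [← Matrix.vecMul_injective_iff]
  intro x y hxy
  have hxy : Matrix.vecMul x P = Matrix.vecMul y P := hxy
  have := congrArg (fun z => Matrix.vecMul z R) hxy
  simpa [Matrix.vecMul_vecMul, h] using this

theorem finrank_ker {F : Type} [Field F] {n i : ℕ} (P : Matrix (Fin i) (Fin n) F)
    (h : LinearIndependent F P.row) :
    i + Module.finrank F (LinearMap.ker P.mulVecLin) = n := by
  have h1 := h.rank_matrix
  have := LinearMap.finrank_range_add_finrank_ker P.mulVecLin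
  rw [← Matrix.rank, h1] at this
  simpa using this

theorem Rel.size_unique {F : Type} [Field F] {ℓ m n i j : ℕ} {M : LFT F ℓ m n}
    {M₁ : LFT F ℓ m i} {M₂ : LFT F ℓ m j}
    {P₁ : Matrix (Fin i) (Fin n) F} {P₂ : Matrix (Fin j) (Fin n) F}
    (h₁ : Rel M M₁ P₁) (h₂ : Rel M M₂ P₂) (c₁ : M₁.IsCanonical) (c₂ : M₂.IsCanonical)
    (l₁ : LinearIndependent F P₁.row) (l₂ : LinearIndependent F P₂.row) : i = j := by
  have k₁ := h₁.ker ((li_iff_ker _).1 c₁.1)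
  have k₂ := h₂.ker ((li_iff_ker _).1 c₂.1)
  have : LinearMap.ker P₁.mulVecLin = LinearMap.ker P₂.mulVecLin := by
    ext s
    simp [← k₁, ← k₂]
  have a₁ := finrank_ker P₁ l₁
  have a₂ := finrank_ker P₂ l₂
  rw [this] at a₁
  omega

theorem Rel.unique {F : Type} [Field F] {ℓ m n i : ℕ} {M : LFT F ℓ m n}
    {M₁ M₂ : LFT F ℓ m i} {P₁ P₂ : Matrix (Fin i) (Fin n) F}
    (h₁ : Rel M M₁ P₁) (h₂ : Rel M M₂ P₂) (c₁ : M₁.IsCanonical) (c₂ : M₂.IsCanonical)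
    (l₁ : LinearIndependent F P₁.row) : M₁ = M₂ ∧ P₁ = P₂ := by
  have k₁ := h₁.ker ((li_iff_ker _).1 c₁.1)
  have k₂ := h₂.ker ((li_iff_ker _).1 c₂.1)
  obtain ⟨R, hR⟩ := rinv_of_li P₁ l₁
  have hcancel : ∀ {a : ℕ} (U V : Matrix (Fin a) (Fin i) F), U * P₁ = V * P₁ → U = V := by
    intro a U V h
    have := congrArg (· * R) h
    simpa [Matrix.mul_assoc, hR] using this
  have hQ : P₂ = P₂ * R * P₁ := by
    apply Matrix.ext_of_mulVec_single
    intro j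
    have h0 : P₁.mulVec (Pi.single j 1 - (R * P₁).mulVec (Pi.single j 1)) = 0 := by
      rw [Matrix.mulVec_sub, Matrix.mulVec_mulVec, ← Matrix.mul_assoc, hR, Matrix.one_mul, sub_self]
    rw [← k₁, k₂, Matrix.mulVec_sub, Matrix.mulVec_mulVec, ← Matrix.mul_assoc] at h0
    exact sub_eq_zero.1 h0
  have hQ1 : P₂ * R = 1 := by
    apply rref_unique M₁.diagMat M₂.diagMat (P₂ * R) _ c₁.2 c₂.2
    apply diag_mul
    intro k
    apply hcancel
    rw [← h₁.obs, h₂.obs, Matrix.mul_assoc _ (P₂ * R), ← hQ]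
  rw [hQ1, Matrix.one_mul] at hQ
  subst hQ
  refine ⟨?_, rfl⟩
  have e1 : M₁.A = M₂.A := hcancel _ _ (h₁.hA.symm.trans h₂.hA)
  have e2 : M₁.B = M₂.B := h₁.hB.symm.trans h₂.hB
  have e3 : M₁.C = M₂.C := hcancel _ _ (h₁.hC.symm.trans h₂.hC)
  have e4 : M₁.D = M₂.D := h₁.hD.symm.trans h₂.hD
  cases M₁; cases M₂
  simp only at e1 e2 e3 e4
  subst e1 e2 e3 e4
  rfl

/-- The unobservable subspace. -/
def kerSub {F : Type} [Field F] {ℓ m n : ℕ} (M : LFT F ℓ m n) : Submodule F (Fin n → F) where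
  carrier := {s | M.Ker s}
  zero_mem' := fun k => by simp
  add_mem' := fun {a b} ha hb k => by rw [Matrix.mulVec_add, ha k, hb k, add_zero]
  smul_mem' := fun c x hx k => by rw [Matrix.mulVec_smul, hx k, smul_zero]

theorem exists_rel {F : Type} [Field F] {ℓ m n : ℕ} (M : LFT F ℓ m n) :
    ∃ (i : ℕ) (M' : LFT F ℓ m i) (P : Matrix (Fin i) (Fin n) F),
      M'.IsCanonical ∧ LinearIndependent F P.row ∧ Rel M M' P := by
  let i := Module.finrank F ((Fin n → F) ⧸ M.kerSub)
  let e : ((Fin n → F) ⧸ M.kerSub) ≃ₗ[F] (Fin i → F) :=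
    LinearEquiv.ofFinrankEq _ _ (by simp [i])
  let f : (Fin n → F) →ₗ[F] (Fin i → F) := e.toLinearMap ∘ₗ M.kerSub.mkQ
  let P := LinearMap.toMatrix' f
  have hPf : ∀ s, P.mulVec s = f s := fun s => LinearMap.toMatrix'_mulVec f s
  have hPk : ∀ s, P.mulVec s = 0 ↔ M.Ker s := by
    intro s
    rw [hPf]
    simp only [f, LinearMap.comp_apply, LinearEquiv.coe_coe, LinearEquiv.map_eq_zero_iff,
      Submodule.mkQ_apply, Submodule.Quotient.mk_eq_zero]
    rfl
  obtain ⟨R, hR⟩ : ∃ R : Matrix (Fin n) (Fin i) F, P * R = 1 := by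
    rw [← Matrix.mulVec_surjective_iff_exists_right_inverse]
    intro y
    obtain ⟨x, hx⟩ := M.kerSub.mkQ_surjective (e.symm y)
    refine ⟨x, ?_⟩
    rw [hPf]
    simp only [f, LinearMap.comp_apply, hx]
    simp
  have hfac : ∀ {a : ℕ} (U : Matrix (Fin a) (Fin n) F), (∀ s, M.Ker s → U.mulVec s = 0) →
      U = U * R * P := by
    intro a U hU
    apply Matrix.ext_of_mulVec_single
    intro j
    have h0 : P.mulVec (Pi.single j 1 - (R * P).mulVec (Pi.single j 1)) = 0 := by
      rw [Matrix.mulVec_sub, Matrix.mulVec_mulVec, ← Matrix.mul_assoc, hR, Matrix.one_mul, sub_self]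
    have h0 := hU _ ((hPk _).1 h0)
    rw [Matrix.mulVec_sub, Matrix.mulVec_mulVec, ← Matrix.mul_assoc] at h0
    exact sub_eq_zero.1 h0
  let M0 : LFT F ℓ m i := ⟨P * M.A * R, P * M.B, M.C * R, M.D⟩
  have hrel0 : Rel M M0 P := by
    refine ⟨?_, rfl, ?_, rfl⟩
    · apply hfac
      intro s hs
      rw [← Matrix.mulVec_mulVec, hPk]
      intro k
      rw [Matrix.mulVec_mulVec, Matrix.mul_assoc, ← pow_succ]
      exact hs _
    · apply hfac
      intro s hs
      simpa using hs 0
  have hM0 : ∀ s, M0.Ker s → s = 0 := by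
    intro s hs
    have hs' : P.mulVec (R.mulVec s) = s := by
      rw [Matrix.mulVec_mulVec, hR, Matrix.one_mulVec]
    rw [← hs', hPk]
    intro k
    rw [hrel0.obs, ← Matrix.mulVec_mulVec, hs']
    exact hs k
  obtain ⟨G, H, hGH, hHG, hrref⟩ := exists_rref M0.diagMat
    (fun s hs => hM0 s ((ker_iff_diag _ _).2 hs))
  let M' : LFT F ℓ m i := ⟨H * M0.A * G, H * M0.B, M0.C * G, M0.D⟩
  have hrel1 : Rel M0 M' H := by
    refine ⟨?_, rfl, ?_, rfl⟩
    · show _ = H * M0.A * G * H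
      rw [Matrix.mul_assoc _ G, hGH, Matrix.mul_one]
    · show _ = M0.C * G * H
      rw [Matrix.mul_assoc _ G, hGH, Matrix.mul_one]
  have hobs : ∀ k, M'.C * M'.A ^ k = M0.C * M0.A ^ k * G := by
    intro k
    rw [hrel1.obs, Matrix.mul_assoc _ H, hHG, Matrix.mul_one]
  refine ⟨i, M', H * P, ⟨?_, ?_⟩, ?_, ?_, ?_, ?_, ?_⟩
  · rw [li_iff_ker]
    intro s hs
    have h1 : G.mulVec s = 0 := by
      apply hM0
      intro k
      rw [Matrix.mulVec_mulVec, ← hobs]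
      exact hs k
    have := congrArg H.mulVec h1
    simpa [hHG] using this
  · rw [diag_mul M' M0 G hobs]
    exact hrref
  · apply li_of_rinv _ (R * G)
    rw [Matrix.mul_assoc, ← Matrix.mul_assoc P, hR, Matrix.one_mul, hHG]
  · rw [Matrix.mul_assoc, hrel0.hA, ← Matrix.mul_assoc, hrel1.hA, Matrix.mul_assoc]
  · rw [Matrix.mul_assoc, hrel0.hB, hrel1.hB]
  · rw [← Matrix.mul_assoc, ← hrel1.hC, hrel0.hC]
  · rw [hrel0.hD, hrel1.hD]

theorem card_fiber {n i k : ℕ} (hi : i ≤ n) (P : Matrix (Fin i) (Fin n) (ZMod 2))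
    (h : LinearIndependent (ZMod 2) P.row) (Y : Matrix (Fin i) (Fin k) (ZMod 2)) :
    Nat.card {X : Matrix (Fin n) (Fin k) (ZMod 2) // P * X = Y} = 2 ^ (k * (n - i)) := by
  obtain ⟨R, hR⟩ := rinv_of_li P h
  have hR' : ∀ Z : Matrix (Fin i) (Fin k) (ZMod 2), P * (R * Z) = Z := by
    intro Z
    rw [← Matrix.mul_assoc, hR, Matrix.one_mul]
  let e : Matrix (Fin n) (Fin k) (ZMod 2) ≃
      Matrix (Fin i) (Fin k) (ZMod 2) × {X : Matrix (Fin n) (Fin k) (ZMod 2) // P * X = Y} :=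
    { toFun := fun X => (P * X, ⟨X - R * (P * X) + R * Y, by
        rw [Matrix.mul_add, Matrix.mul_sub, hR', hR']; simp⟩)
      invFun := fun z => z.2.1 + R * z.1 - R * Y
      left_inv := fun X => by
        simp only
        abel
      right_inv := fun z => by
        obtain ⟨Z, W, hW⟩ := z
        have : P * (W + R * Z - R * Y) = Z := by
          rw [Matrix.mul_sub, Matrix.mul_add, hR', hR', hW]; simp
        simp only [this, Prod.mk.injEq, Subtype.mk.injEq, true_and]
        abel }
  have h1 := Nat.card_congr e
  rw [Nat.card_prod] at h1
  have hc : ∀ a : ℕ, Nat.card (Matrix (Fin a) (Fin k) (ZMod 2)) = 2 ^ (k * a) := by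
    intro a
    unfold Matrix
    simp [pow_mul]
  rw [hc, hc] at h1
  have h2 : k * n = k * i + k * (n - i) := by
    rw [← Nat.mul_add, Nat.add_sub_cancel' hi]
  rw [h2, pow_add] at h1
  exact (Nat.eq_of_mul_eq_mul_left (by positivity) h1).symm

/-- The parametrising data at size `i`. -/
abbrev Dat (ℓ m n i : ℕ) : Type :=
  Σ M' : {M : LFT (ZMod 2) ℓ m i // M.IsCanonical},
    Σ P : {P : Fin i → (Fin n → ZMod 2) // LinearIndependent (ZMod 2) P},
      {A : Matrix (Fin n) (Fin n) (ZMod 2) // Matrix.of P.1 * A = M'.1.A * Matrix.of P.1} ×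
      {B : Matrix (Fin n) (Fin ℓ) (ZMod 2) // Matrix.of P.1 * B = M'.1.B}

theorem finite_Dat (ℓ m n i : ℕ) : Finite (Dat ℓ m n i) := by
  have := finite_LFT ℓ m i
  infer_instance

theorem card_Dat (ℓ m n i : ℕ) (hi : i ≤ n) : Nat.card (Dat ℓ m n i) =
    CT ℓ m i * ((∏ j ∈ Finset.range i, (2 ^ n - 2 ^ j)) * 2 ^ ((n + ℓ) * (n - i))) := by
  have := finite_LFT ℓ m i
  have := Fintype.ofFinite {M : LFT (ZMod 2) ℓ m i // M.IsCanonical}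
  have := Fintype.ofFinite {P : Fin i → (Fin n → ZMod 2) // LinearIndependent (ZMod 2) P}
  rw [Nat.card_sigma]
  have key : ∀ M' : {M : LFT (ZMod 2) ℓ m i // M.IsCanonical}, Nat.card
     (Σ P : {P : Fin i → (Fin n → ZMod 2) // LinearIndependent (ZMod 2) P},
      {A : Matrix (Fin n) (Fin n) (ZMod 2) // Matrix.of P.1 * A = M'.1.A * Matrix.of P.1} ×
      {B : Matrix (Fin n) (Fin ℓ) (ZMod 2) // Matrix.of P.1 * B = M'.1.B}) =
      ((∏ j ∈ Finset.range i, (2 ^ n - 2 ^ j)) * 2 ^ ((n + ℓ) * (n - i))) := by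
    intro M'
    rw [Nat.card_sigma]
    have : ∀ P : {P : Fin i → (Fin n → ZMod 2) // LinearIndependent (ZMod 2) P}, Nat.card
      ({A : Matrix (Fin n) (Fin n) (ZMod 2) // Matrix.of P.1 * A = M'.1.A * Matrix.of P.1} ×
      {B : Matrix (Fin n) (Fin ℓ) (ZMod 2) // Matrix.of P.1 * B = M'.1.B}) =
        2 ^ ((n + ℓ) * (n - i)) := by
      intro P
      rw [Nat.card_prod, card_fiber hi (Matrix.of P.1) P.2,
        card_fiber hi (Matrix.of P.1) P.2, ← pow_add, Nat.add_mul]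
    simp only [this]
    rw [Finset.sum_const, Finset.card_univ, ← Nat.card_eq_fintype_card,
      card_linearIndependent (by simpa using hi), smul_eq_mul, Finset.prod_range]
    simp
  simp only [key]
  rw [Finset.sum_const, Finset.card_univ, ← Nat.card_eq_fintype_card, smul_eq_mul, CT]

/-- The transducer built from the data. -/
def Dat.toLFT {ℓ m n i : ℕ} (d : Dat ℓ m n i) : LFT (ZMod 2) ℓ m n :=
  ⟨d.2.2.1.1, d.2.2.2.1, d.1.1.C * Matrix.of d.2.1.1, d.1.1.D⟩

theorem Dat.rel {ℓ m n i : ℕ} (d : Dat ℓ m n i) : Rel d.toLFT d.1.1 (Matrix.of d.2.1.1) :=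
  ⟨d.2.2.1.2, d.2.2.2.2, rfl, rfl⟩

theorem rel_range {F : Type} [Field F] {ℓ m n i : ℕ} {M : LFT F ℓ m n} {M' : LFT F ℓ m i}
    {P : Matrix (Fin i) (Fin n) F} (h : Rel M M' P) (c : M'.IsCanonical)
    (l : LinearIndependent F P.row) :
    (M.C ≠ 0 ∧ ¬ M.Minimal) ↔ (1 ≤ i ∧ i < n) := by
  have hk := h.ker ((li_iff_ker _).1 c.1)
  have hf := finrank_ker P l
  have h1 : M.C ≠ 0 ↔ 1 ≤ i := by
    constructor
    · intro hC
      by_contra hi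
      obtain rfl : i = 0 := by omega
      apply hC
      rw [h.hC]
      ext a b
      simp [Matrix.mul_apply]
    · intro hi hC
      have hall : ∀ s, P.mulVec s = 0 := by
        intro s
        rw [← hk]
        intro k
        rw [hC]; simp
      have : LinearMap.ker P.mulVecLin = ⊤ := by
        ext s; simp [hall]
      rw [this] at hf
      simp at hf
      omega
  have h2 : M.Minimal ↔ ¬ i < n := by
    rw [minimal_iff]
    have h3 : (∀ s, M.Ker s → s = 0) ↔ LinearMap.ker P.mulVecLin = ⊥ := by
      rw [LinearMap.ker_eq_bot']
      simp [hk]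
    rw [h3, ← Submodule.finrank_eq_zero]
    omega
  rw [h1, h2, not_not]

end LFT

/-- the number of non-trivial, non-minimal LFTs over `F₂` with structural
parameters `ℓ, m, n` (where `n ≥ 2`) equals
`Σ_{i=1}^{n−1} CT(ℓ,m,i) · ∏_{j=0}^{i−1}(2ⁿ − 2^j) · 2^{(n+ℓ)(n−i)}`. -/
theorem count_nontrivial_nonminimal (ℓ m n : ℕ) (hℓ : 0 < ℓ) (hm : 0 < m) (hn : 2 ≤ n) :
    Nat.card {M : LFT (ZMod 2) ℓ m n // M.C ≠ 0 ∧ ¬ M.Minimal} =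
      ∑ i ∈ Finset.Icc 1 (n - 1),
        CT ℓ m i * ((∏ j ∈ Finset.range i, (2 ^ n - 2 ^ j)) * 2 ^ ((n + ℓ) * (n - i))) := by
  classical
  have key : Function.Bijective
      (fun d : (Σ i : (Finset.Icc 1 (n - 1) : Finset ℕ), LFT.Dat ℓ m n i) =>
        (⟨d.2.toLFT, (LFT.rel_range d.2.rel d.2.1.2 d.2.2.1.2).2 (by
          have := Finset.mem_Icc.1 d.1.2
          omega)⟩ : {M : LFT (ZMod 2) ℓ m n // M.C ≠ 0 ∧ ¬ M.Minimal})) := by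
    constructor
    · rintro ⟨⟨i, hi⟩, d⟩ ⟨⟨j, hj⟩, d'⟩ hdd
      have hdd : d.toLFT = d'.toLFT := congrArg Subtype.val hdd
      have r := d.rel
      have r' := d'.rel
      rw [← hdd] at r'
      obtain rfl : i = j := LFT.Rel.size_unique r r' d.1.2 d'.1.2 d.2.1.2 d'.2.1.2
      obtain ⟨e1, e2⟩ := LFT.Rel.unique r r' d.1.2 d'.1.2 d.2.1.2
      obtain ⟨⟨M1, c1⟩, ⟨P1, l1⟩, ⟨A1, a1⟩, ⟨B1, b1⟩⟩ := d
      obtain ⟨⟨M2, c2⟩, ⟨P2, l2⟩, ⟨A2, a2⟩, ⟨B2, b2⟩⟩ := d'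
      simp only [LFT.Dat.toLFT, LFT.mk.injEq] at hdd
      obtain ⟨rfl, rfl, -, -⟩ := hdd
      have e1 : M1 = M2 := e1
      have e2 : P1 = P2 := e2
      subst e1 e2
      rfl
    · rintro ⟨M, hM⟩
      obtain ⟨i, M', P, c, l, r⟩ := LFT.exists_rel M
      have hi := (LFT.rel_range r c l).1 hM
      refine ⟨⟨⟨i, Finset.mem_Icc.2 (by omega)⟩, ⟨M', c⟩, ⟨P, l⟩, ⟨M.A, r.hA⟩, ⟨M.B, r.hB⟩⟩, ?_⟩
      apply Subtype.ext
      have h3 := r.hC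
      have h4 := r.hD
      cases M
      simp only at h3 h4
      subst h3 h4
      rfl
  rw [← Nat.card_congr (Equiv.ofBijective _ key)]
  have := fun i => LFT.finite_Dat ℓ m n i
  rw [Nat.card_sigma, ← Finset.sum_coe_sort (Finset.Icc 1 (n - 1)) (fun i =>
    CT ℓ m i * ((∏ j ∈ Finset.range i, (2 ^ n - 2 ^ j)) * 2 ^ ((n + ℓ) * (n - i))))]
  apply Finset.sum_congr rfl
  intro i _
  have := Finset.mem_Icc.1 i.2
  exact LFT.card_Dat ℓ m n i (by omega)
end
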